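/- arXiv:1609.00672 — 4 statements merged into one kernel-verified Lean document; each statement's English description precedes it below -/
import Mathlib

section
/- If a probability distribution P on ({0,1})^3 is compatible with the Triangle scenario, then P_A(1)·P_B(1)·P_C(1) ≤ P_{AB}(1,1)·P_C(1) + P_{BC}(1,1)·P_A(1) + P_{AC}(1,1)·P_B(1) + P(0,0,0), where P_A, P_B, P_C are the single-variable marginals and P_{AB}, P_{BC}, P_{AC} the two-variable marginals of P. -/
open scoped BigOperators NNReal

/-- Compatibility of a distribution on `{0,1}³` with the Triangle causal scenario:
there are latent variables `X`, `Y`, `Z` with probability mass functions, and conditional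
distributions for each observed node given its two latent parents, reproducing `P`. -/
def TriangleCompatible (P : Fin 2 → Fin 2 → Fin 2 → ℝ) : Prop :=
  ∃ (X Y Z : Type) (μX : X → ℝ≥0) (μY : Y → ℝ≥0) (μZ : Z → ℝ≥0)
    (qA : Y × Z → Fin 2 → ℝ≥0) (qB : X × Z → Fin 2 → ℝ≥0) (qC : X × Y → Fin 2 → ℝ≥0),
    (∑' x, μX x) = 1 ∧ (∑' y, μY y) = 1 ∧ (∑' z, μZ z) = 1 ∧
    (∀ yz, ∑ a, qA yz a = 1) ∧
    (∀ xz, ∑ b, qB xz b = 1) ∧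
    (∀ xy, ∑ c, qC xy c = 1) ∧
    ∀ a b c, P a b c =
      ((∑' (x : X) (y : Y) (z : Z),
        μX x * μY y * μZ z * qA (y, z) a * qB (x, z) b * qC (x, y) c : ℝ≥0) : ℝ)

open scoped ENNReal

/-- A `tsum` of nonnegative reals commutes with the coercion to `ℝ≥0∞` when the latter sum is
finite. -/
theorem coe_tsum_of_ne_top {ι : Type*} {f : ι → ℝ≥0} (h : ∑' i, (f i : ℝ≥0∞) ≠ ⊤) :
    ((∑' i, f i : ℝ≥0) : ℝ≥0∞) = ∑' i, (f i : ℝ≥0∞) :=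
  ENNReal.coe_tsum (ENNReal.tsum_coe_ne_top_iff_summable.1 h)

theorem coe_tsum_tsum_tsum_of_ne_top {ι κ τ : Type*} {f : ι → κ → τ → ℝ≥0}
    (h : ∑' p : ι × κ × τ, (f p.1 p.2.1 p.2.2 : ℝ≥0∞) ≠ ⊤) :
    ((∑' (i) (j) (k), f i j k : ℝ≥0) : ℝ≥0∞) =
      ∑' p : ι × κ × τ, (f p.1 p.2.1 p.2.2 : ℝ≥0∞) := by
  rw [ENNReal.tsum_prod'] at h ⊢
  simp_rw [ENNReal.tsum_prod'] at h ⊢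
  have h₁ (i) := ENNReal.ne_top_of_tsum_ne_top h i
  have h₂ (i j) := ENNReal.ne_top_of_tsum_ne_top (h₁ i) j
  have e₂ (i j) := coe_tsum_of_ne_top (h₂ i j)
  have e₁ (i) : ((∑' (j) (k), f i j k : ℝ≥0) : ℝ≥0∞) = ∑' (j) (k), (f i j k : ℝ≥0∞) := by
    simp_rw [← e₂]
    exact coe_tsum_of_ne_top (by simpa only [e₂] using h₁ i)
  simp_rw [← e₁]
  exact coe_tsum_of_ne_top (by simpa only [e₁] using h)

theorem coe_tsum_eq_one {ι : Type*} {μ : ι → ℝ≥0} (h : ∑' i, μ i = 1) :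
    ∑' i, (μ i : ℝ≥0∞) = 1 := by
  rw [← ENNReal.coe_tsum, h, ENNReal.coe_one]
  by_contra hμ
  simp [tsum_eq_zero_of_not_summable hμ] at h

theorem ENNReal.tsum_mul_tsum_eq_tsum_prod {ι κ : Type*} (f : ι → ℝ≥0∞) (g : κ → ℝ≥0∞) :
    (∑' i, f i) * ∑' j, g j = ∑' p : ι × κ, f p.1 * g p.2 := by
  simp_rw [ENNReal.tsum_prod', ENNReal.tsum_mul_left, ENNReal.tsum_mul_right]

/-- The inequality satisfied by the response probabilities in the spiral inflation of the
Triangle, at fixed values of all latent variables. -/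
theorem spiral_response_inequality {a₀ a₁ b₀ b₁ c₀ c₁ a b c : ℝ≥0}
    (ha₁ : a₀ + a₁ = 1) (hb₁ : b₀ + b₁ = 1) (hc₁ : c₀ + c₁ = 1)
    (ha : a ≤ 1) (hb : b ≤ 1) (hc : c ≤ 1) :
    a * b * c ≤ a₁ * b * c + b₁ * c * a + a * c₁ * b + a₀ * b₀ * c₀ := by
  have key : 1 ≤ a₁ + b₁ + c₁ + a₀ * b₀ * c₀ := by
    rw [← NNReal.coe_le_coe]
    have ha' : (a₀ : ℝ) = 1 - a₁ := by rw [eq_sub_iff_add_eq]; exact_mod_cast ha₁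
    have hb' : (b₀ : ℝ) = 1 - b₁ := by rw [eq_sub_iff_add_eq]; exact_mod_cast hb₁
    have hc' : (c₀ : ℝ) = 1 - c₁ := by rw [eq_sub_iff_add_eq]; exact_mod_cast hc₁
    have h₁ : 0 ≤ (a₁ * b₁ : ℝ) * c₀ := by positivity
    have h₂ : 0 ≤ (c₁ : ℝ) * (a₁ + b₁) := by positivity
    push_cast
    rw [ha', hb']
    rw [hc'] at h₁ ⊢
    linarith
  calc a * b * c = a * b * c * 1 := (mul_one _).symm
    _ ≤ a * b * c * (a₁ + b₁ + c₁ + a₀ * b₀ * c₀) := by gcongr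
    _ = a * (a₁ * b * c) + b * (b₁ * c * a) + c * (c₁ * a * b)
          + a * b * c * (a₀ * b₀ * c₀) := by ring
    _ ≤ 1 * (a₁ * b * c) + 1 * (b₁ * c * a) + 1 * (c₁ * a * b)
          + 1 * 1 * 1 * (a₀ * b₀ * c₀) := by gcongr
    _ = _ := by ring

section Spiral

variable {X Y Z : Type*} {μX : X → ℝ≥0∞} {μY : Y → ℝ≥0∞} {μZ : Z → ℝ≥0∞}

/-- The expectation, with respect to the weights `μX`, `μY`, `μZ`, of a function of two
independent copies of each of the latent variables. -/
noncomputable def spiralExp (μX : X → ℝ≥0∞) (μY : Y → ℝ≥0∞) (μZ : Z → ℝ≥0∞)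
    (f : X → X → Y → Y → Z → Z → ℝ≥0∞) : ℝ≥0∞ :=
  ∑' p : (X × X) × (Y × Y) × (Z × Z),
    μX p.1.1 * μX p.1.2 * (μY p.2.1.1 * μY p.2.1.2) * (μZ p.2.2.1 * μZ p.2.2.2) *
      f p.1.1 p.1.2 p.2.1.1 p.2.1.2 p.2.2.1 p.2.2.2

theorem spiralExp_mono {f g : X → X → Y → Y → Z → Z → ℝ≥0∞}
    (h : ∀ x x' y y' z z', f x x' y y' z z' ≤ g x x' y y' z z') :
    spiralExp μX μY μZ f ≤ spiralExp μX μY μZ g :=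
  ENNReal.tsum_le_tsum fun _ => mul_le_mul_right (h ..) _

theorem spiralExp_add (f g : X → X → Y → Y → Z → Z → ℝ≥0∞) :
    spiralExp μX μY μZ (fun x x' y y' z z' => f x x' y y' z z' + g x x' y y' z z') =
      spiralExp μX μY μZ f + spiralExp μX μY μZ g := by
  simp_rw [spiralExp, mul_add, ENNReal.tsum_add]

theorem spiralExp_independent (f : Y → Z → ℝ≥0∞) (g : X → Z → ℝ≥0∞) (h : X → Y → ℝ≥0∞) :
    spiralExp μX μY μZ (fun x x' y y' z z' => f y z' * g x' z * h x y') =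
      (∑' p : Y × Z, μY p.1 * μZ p.2 * f p.1 p.2) *
        (∑' p : X × Z, μX p.1 * μZ p.2 * g p.1 p.2) *
        (∑' p : X × Y, μX p.1 * μY p.2 * h p.1 p.2) := by
  let e : (X × X) × (Y × Y) × (Z × Z) ≃ ((Y × Z) × (X × Z)) × (X × Y) :=
    ⟨fun p => (((p.2.1.1, p.2.2.2), (p.1.2, p.2.2.1)), (p.1.1, p.2.1.2)),
      fun q => ((q.2.1, q.1.2.1), (q.1.1.1, q.2.2), (q.1.2.2, q.1.1.2)),
      fun _ => rfl, fun _ => rfl⟩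
  simp_rw [ENNReal.tsum_mul_tsum_eq_tsum_prod]
  rw [← e.tsum_eq, spiralExp]
  refine tsum_congr fun p => ?_
  simp only [e, Equiv.coe_fn_mk]
  ring

theorem spiralExp_AB (hZ : ∑' z, μZ z = 1)
    (f : X → Y → Z → ℝ≥0∞) (g : X → Y → ℝ≥0∞) :
    spiralExp μX μY μZ (fun x x' y y' z _ => f x' y z * g x y') =
      (∑' p : X × Y × Z, μX p.1 * μY p.2.1 * μZ p.2.2 * f p.1 p.2.1 p.2.2) *
        (∑' p : X × Y, μX p.1 * μY p.2 * g p.1 p.2) := by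
  let e : (X × X) × (Y × Y) × (Z × Z) ≃ ((X × Y × Z) × (X × Y)) × Z :=
    ⟨fun p => (((p.1.2, p.2.1.1, p.2.2.1), (p.1.1, p.2.1.2)), p.2.2.2),
      fun q => ((q.1.2.1, q.1.1.1), (q.1.1.2.1, q.1.2.2), (q.1.1.2.2, q.2)),
      fun _ => rfl, fun _ => rfl⟩
  rw [← mul_one (_ * _), ← hZ]
  simp_rw [ENNReal.tsum_mul_tsum_eq_tsum_prod]
  rw [← e.tsum_eq, spiralExp]
  refine tsum_congr fun p => ?_
  simp only [e, Equiv.coe_fn_mk]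
  ring

theorem spiralExp_BC (hX : ∑' x, μX x = 1)
    (f : X → Y → Z → ℝ≥0∞) (g : Y → Z → ℝ≥0∞) :
    spiralExp μX μY μZ (fun x _ y y' z z' => f x y' z * g y z') =
      (∑' p : X × Y × Z, μX p.1 * μY p.2.1 * μZ p.2.2 * f p.1 p.2.1 p.2.2) *
        (∑' p : Y × Z, μY p.1 * μZ p.2 * g p.1 p.2) := by
  let e : (X × X) × (Y × Y) × (Z × Z) ≃ ((X × Y × Z) × (Y × Z)) × X :=
    ⟨fun p => (((p.1.1, p.2.1.2, p.2.2.1), (p.2.1.1, p.2.2.2)), p.1.2),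
      fun q => ((q.1.1.1, q.2), (q.1.2.1, q.1.1.2.1), (q.1.1.2.2, q.1.2.2)),
      fun _ => rfl, fun _ => rfl⟩
  rw [← mul_one (_ * _), ← hX]
  simp_rw [ENNReal.tsum_mul_tsum_eq_tsum_prod]
  rw [← e.tsum_eq, spiralExp]
  refine tsum_congr fun p => ?_
  simp only [e, Equiv.coe_fn_mk]
  ring

theorem spiralExp_AC (hY : ∑' y, μY y = 1)
    (f : X → Y → Z → ℝ≥0∞) (g : X → Z → ℝ≥0∞) :
    spiralExp μX μY μZ (fun x x' y _ z z' => f x y z' * g x' z) =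
      (∑' p : X × Y × Z, μX p.1 * μY p.2.1 * μZ p.2.2 * f p.1 p.2.1 p.2.2) *
        (∑' p : X × Z, μX p.1 * μZ p.2 * g p.1 p.2) := by
  let e : (X × X) × (Y × Y) × (Z × Z) ≃ ((X × Y × Z) × (X × Z)) × Y :=
    ⟨fun p => (((p.1.1, p.2.1.1, p.2.2.2), (p.1.2, p.2.2.1)), p.2.1.2),
      fun q => ((q.1.1.1, q.1.2.1), (q.1.1.2.1, q.2), (q.1.2.2, q.1.1.2.2)),
      fun _ => rfl, fun _ => rfl⟩
  rw [← mul_one (_ * _), ← hY]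
  simp_rw [ENNReal.tsum_mul_tsum_eq_tsum_prod]
  rw [← e.tsum_eq, spiralExp]
  refine tsum_congr fun p => ?_
  simp only [e, Equiv.coe_fn_mk]
  ring

theorem spiralExp_ABC (hX : ∑' x, μX x = 1) (hY : ∑' y, μY y = 1) (hZ : ∑' z, μZ z = 1)
    (f : X → Y → Z → ℝ≥0∞) :
    spiralExp μX μY μZ (fun x _ y _ z _ => f x y z) =
      ∑' p : X × Y × Z, μX p.1 * μY p.2.1 * μZ p.2.2 * f p.1 p.2.1 p.2.2 := by
  let e : (X × X) × (Y × Y) × (Z × Z) ≃ (((X × Y × Z) × X) × Y) × Z :=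
    ⟨fun p => ((((p.1.1, p.2.1.1, p.2.2.1), p.1.2), p.2.1.2), p.2.2.2),
      fun q => ((q.1.1.1.1, q.1.1.2), (q.1.1.1.2.1, q.1.2), (q.1.1.1.2.2, q.2)),
      fun _ => rfl, fun _ => rfl⟩
  rw [← mul_one (tsum _), ← hX, ← mul_one (_ * _), ← hY, ← mul_one (_ * _ * _), ← hZ]
  simp_rw [ENNReal.tsum_mul_tsum_eq_tsum_prod]
  rw [← e.tsum_eq, spiralExp]
  refine tsum_congr fun p => ?_
  simp only [e, Equiv.coe_fn_mk]
  ring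

end Spiral

/-- If a probability distribution `P` on `{0,1}³` is compatible with the Triangle scenario,
then `P_A(1)·P_B(1)·P_C(1) ≤ P_{AB}(1,1)·P_C(1) + P_{BC}(1,1)·P_A(1) + P_{AC}(1,1)·P_B(1)
+ P(0,0,0)`. -/
theorem triangle_probability_inequality (P : Fin 2 → Fin 2 → Fin 2 → ℝ)
    (hP0 : ∀ a b c, 0 ≤ P a b c)
    (hP1 : ∑ a, ∑ b, ∑ c, P a b c = 1)
    (hcomp : TriangleCompatible P) :
    (∑ b, ∑ c, P 1 b c) * (∑ a, ∑ c, P a 1 c) * (∑ a, ∑ b, P a b 1) ≤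
      (∑ c, P 1 1 c) * (∑ a, ∑ b, P a b 1)
        + (∑ a, P a 1 1) * (∑ b, ∑ c, P 1 b c)
        + (∑ b, P 1 b 1) * (∑ a, ∑ c, P a 1 c)
        + P 0 0 0 := by
  obtain ⟨X, Y, Z, μX, μY, μZ, qA, qB, qC, hX, hY, hZ, hA, hB, hC, hP⟩ := hcomp
  replace hX := coe_tsum_eq_one hX
  replace hY := coe_tsum_eq_one hY
  replace hZ := coe_tsum_eq_one hZ
  have le_one {ι : Type} {q : ι → Fin 2 → ℝ≥0} (hq : ∀ i, ∑ a, q i a = 1) (i a) : q i a ≤ 1 :=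
    hq i ▸ Finset.single_le_sum (fun _ _ => zero_le) (Finset.mem_univ a)
  let S (f : X → Y → Z → ℝ≥0∞) : ℝ≥0∞ :=
    ∑' p : X × Y × Z, (μX p.1 : ℝ≥0∞) * μY p.2.1 * μZ p.2.2 * f p.1 p.2.1 p.2.2
  have S_add (f g) : S f + S g = S (fun x y z => f x y z + g x y z) := by
    simp_rw [S, mul_add, ENNReal.tsum_add]
  have S_one : S (fun _ _ _ => 1) = 1 := by
    simp only [S, mul_one]
    calc _ = (∑' x, (μX x : ℝ≥0∞)) * ((∑' y, (μY y : ℝ≥0∞)) * ∑' z, (μZ z : ℝ≥0∞)) := by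
          simp_rw [ENNReal.tsum_mul_tsum_eq_tsum_prod, mul_assoc]
      _ = 1 := by rw [hX, hY, hZ, one_mul, one_mul]
  let Q (a b c : Fin 2) : ℝ≥0 :=
    ∑' (x : X) (y : Y) (z : Z),
      μX x * μY y * μZ z * qA (y, z) a * qB (x, z) b * qC (x, y) c
  have hQ (a b c) : (Q a b c : ℝ≥0∞) =
      S (fun x y z => (qA (y, z) a : ℝ≥0∞) * qB (x, z) b * qC (x, y) c) := by
    have hS : ∑' p : X × Y × Z,
        ((μX p.1 * μY p.2.1 * μZ p.2.2 * qA (p.2.1, p.2.2) a * qB (p.1, p.2.2) b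
          * qC (p.1, p.2.1) c : ℝ≥0) : ℝ≥0∞) =
        S (fun x y z => (qA (y, z) a : ℝ≥0∞) * qB (x, z) b * qC (x, y) c) := by
      simp only [S, ENNReal.coe_mul, mul_assoc]
    rw [← hS]
    refine coe_tsum_tsum_tsum_of_ne_top (f := fun x y z =>
      μX x * μY y * μZ z * qA (y, z) a * qB (x, z) b * qC (x, y) c) ?_
    rw [hS]
    refine ne_top_of_le_ne_top ENNReal.one_ne_top (S_one ▸ ?_)
    refine ENNReal.tsum_le_tsum fun p => mul_le_mul_right ?_ _
    dsimp only
    exact_mod_cast mul_le_one' (mul_le_one' (le_one hA _ _) (le_one hB _ _)) (le_one hC _ _)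
  have sA (y z) : (qA (y, z) 0 : ℝ≥0∞) + qA (y, z) 1 = 1 := by
    exact_mod_cast Fin.sum_univ_two (qA (y, z)) ▸ hA (y, z)
  have sB (x z) : (qB (x, z) 0 : ℝ≥0∞) + qB (x, z) 1 = 1 := by
    exact_mod_cast Fin.sum_univ_two (qB (x, z)) ▸ hB (x, z)
  have sC (x y) : (qC (x, y) 0 : ℝ≥0∞) + qC (x, y) 1 = 1 := by
    exact_mod_cast Fin.sum_univ_two (qC (x, y)) ▸ hC (x, y)
  have mAB : ∑ c, (Q 1 1 c : ℝ≥0∞) = S fun x y z => (qA (y, z) 1 : ℝ≥0∞) * qB (x, z) 1 := by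
    simp_rw [Fin.sum_univ_two, hQ, S_add, ← mul_add, sC, mul_one]
  have mBC : ∑ a, (Q a 1 1 : ℝ≥0∞) = S fun x y z => (qB (x, z) 1 : ℝ≥0∞) * qC (x, y) 1 := by
    simp_rw [Fin.sum_univ_two, hQ, S_add, ← add_mul, sA, one_mul]
  have mAC : ∑ b, (Q 1 b 1 : ℝ≥0∞) = S fun x y z => (qA (y, z) 1 : ℝ≥0∞) * qC (x, y) 1 := by
    simp_rw [Fin.sum_univ_two, hQ, S_add, ← add_mul, ← mul_add, sB, mul_one]
  have mA : ∑ b, ∑ c, (Q 1 b c : ℝ≥0∞) =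
      ∑' p : Y × Z, (μY p.1 : ℝ≥0∞) * μZ p.2 * qA (p.1, p.2) 1 := by
    simp_rw [Fin.sum_univ_two, hQ, S_add, ← mul_add, sC, mul_one, ← mul_add, sB, mul_one]
    rw [← one_mul (∑' p : Y × Z, _), ← hX, ENNReal.tsum_mul_tsum_eq_tsum_prod]
    simp only [S, mul_assoc]
  have mB : ∑ a, ∑ c, (Q a 1 c : ℝ≥0∞) =
      ∑' p : X × Z, (μX p.1 : ℝ≥0∞) * μZ p.2 * qB (p.1, p.2) 1 := by
    let e : X × Y × Z ≃ Y × X × Z :=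
      ⟨fun p => (p.2.1, p.1, p.2.2), fun p => (p.2.1, p.1, p.2.2), fun _ => rfl, fun _ => rfl⟩
    simp_rw [Fin.sum_univ_two, hQ, S_add, ← mul_add, sC, mul_one, ← add_mul, sA, one_mul]
    rw [← one_mul (∑' p : X × Z, _), ← hY, ENNReal.tsum_mul_tsum_eq_tsum_prod, ← e.tsum_eq]
    refine tsum_congr fun p => ?_
    simp only [e, Equiv.coe_fn_mk]
    ring
  have mC : ∑ a, ∑ b, (Q a b 1 : ℝ≥0∞) =
      ∑' p : X × Y, (μX p.1 : ℝ≥0∞) * μY p.2 * qC (p.1, p.2) 1 := by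
    let e : X × Y × Z ≃ Z × X × Y :=
      ⟨fun p => (p.2.2, p.1, p.2.1), fun p => (p.2.1, p.2.2, p.1), fun _ => rfl, fun _ => rfl⟩
    simp_rw [Fin.sum_univ_two, hQ, S_add, ← add_mul, ← mul_add, sB, mul_one, sA, one_mul]
    rw [← one_mul (∑' p : X × Y, _), ← hZ, ENNReal.tsum_mul_tsum_eq_tsum_prod, ← e.tsum_eq]
    refine tsum_congr fun p => ?_
    simp only [e, Equiv.coe_fn_mk]
    ring
  have main : (∑ b, ∑ c, (Q 1 b c : ℝ≥0∞)) * (∑ a, ∑ c, (Q a 1 c : ℝ≥0∞))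
        * (∑ a, ∑ b, (Q a b 1 : ℝ≥0∞)) ≤
      (∑ c, (Q 1 1 c : ℝ≥0∞)) * (∑ a, ∑ b, (Q a b 1 : ℝ≥0∞))
        + (∑ a, (Q a 1 1 : ℝ≥0∞)) * (∑ b, ∑ c, (Q 1 b c : ℝ≥0∞))
        + (∑ b, (Q 1 b 1 : ℝ≥0∞)) * (∑ a, ∑ c, (Q a 1 c : ℝ≥0∞))
        + Q 0 0 0 := by
    rw [mA, mB, mC, mAB, mBC, mAC, hQ]
    let mX : X → ℝ≥0∞ := fun x => μX x
    let mY : Y → ℝ≥0∞ := fun y => μY y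
    let mZ : Z → ℝ≥0∞ := fun z => μZ z
    refine (spiralExp_independent (μX := mX) (μY := mY) (μZ := mZ)
      (fun y z => (qA (y, z) 1 : ℝ≥0∞))
      (fun x z => (qB (x, z) 1 : ℝ≥0∞)) (fun x y => (qC (x, y) 1 : ℝ≥0∞))).symm.trans_le ?_
    refine LE.le.trans_eq ?_ (congrArg₂ (· + ·) (congrArg₂ (· + ·) (congrArg₂ (· + ·)
      (spiralExp_AB (μX := mX) (μY := mY) (μZ := mZ) hZ
        (fun x y z => (qA (y, z) 1 : ℝ≥0∞) * qB (x, z) 1)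
        (fun x y => (qC (x, y) 1 : ℝ≥0∞)))
      (spiralExp_BC (μX := mX) (μY := mY) (μZ := mZ) hX
        (fun x y z => (qB (x, z) 1 : ℝ≥0∞) * qC (x, y) 1)
        (fun y z => (qA (y, z) 1 : ℝ≥0∞))))
      (spiralExp_AC (μX := mX) (μY := mY) (μZ := mZ) hY
        (fun x y z => (qA (y, z) 1 : ℝ≥0∞) * qC (x, y) 1)
        (fun x z => (qB (x, z) 1 : ℝ≥0∞))))
      (spiralExp_ABC (μX := mX) (μY := mY) (μZ := mZ) hX hY hZ
        (fun x y z => (qA (y, z) 0 : ℝ≥0∞) * qB (x, z) 0 * qC (x, y) 0)))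
    simp only [← spiralExp_add]
    refine spiralExp_mono fun x x' y y' z z' => ?_
    have h := spiral_response_inequality
      (Fin.sum_univ_two (qA (y, z)) ▸ hA (y, z)) (Fin.sum_univ_two (qB (x, z)) ▸ hB (x, z))
      (Fin.sum_univ_two (qC (x, y)) ▸ hC (x, y))
      (le_one hA (y, z') 1) (le_one hB (x', z) 1) (le_one hC (x, y') 1)
    exact_mod_cast h
  have hPQ (a b c) : P a b c = (Q a b c : ℝ) := hP a b c
  simp only [hPQ]
  exact_mod_cast main
end

section
/- For every real α with 5/8 < α ≤ 1, the noisy perfectly-correlated distribution P_α on three binary variables, defined by P_α(a,b,c) = α/2 if a = b = c and P_α(a,b,c) = (1−α)/6 otherwise, is not compatible with the Triangle scenario. -/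
open scoped BigOperators NNReal

open scoped ENNReal

/-- The expectation of `f` over three independent latent variables with masses `mX`, `mY`, `mZ`. -/
noncomputable def latentMean {X Y Z : Type*} (mX : X → ℝ≥0∞) (mY : Y → ℝ≥0∞) (mZ : Z → ℝ≥0∞)
    (f : X → Y → Z → ℝ≥0∞) : ℝ≥0∞ :=
  ∑' (x : X) (y : Y) (z : Z), mX x * mY y * mZ z * f x y z

section LatentMean

variable {X Y Z : Type*} {mX : X → ℝ≥0∞} {mY : Y → ℝ≥0∞} {mZ : Z → ℝ≥0∞}

lemma latentMean_add (f g : X → Y → Z → ℝ≥0∞) :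
    latentMean mX mY mZ (fun x y z => f x y z + g x y z) =
      latentMean mX mY mZ f + latentMean mX mY mZ g := by
  simp only [latentMean, mul_add, ENNReal.tsum_add]

lemma latentMean_eq_tsum_tsum (f : X → Y → Z → ℝ≥0∞) :
    latentMean mX mY mZ f = ∑' (x : X) (z : Z), mX x * mZ z * ∑' y, mY y * f x y z := by
  refine tsum_congr fun x => ?_
  rw [ENNReal.tsum_comm]
  refine tsum_congr fun z => ?_
  rw [← ENNReal.tsum_mul_left]
  exact tsum_congr fun y => by ring

/-- The inequality obtained by cutting the latent variable `Y` into two independent copies: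
the events `A` and `C`, made independent, still satisfy the union bound through `B`. -/
lemma latentMean_mul_latentMean_le (hX : ∑' x, mX x = 1) (hY : ∑' y, mY y = 1)
    (hZ : ∑' z, mZ z = 1) (A : Y → Z → ℝ≥0∞) (B B' : X → Z → ℝ≥0∞) (C : X → Y → ℝ≥0∞)
    (hA : ∀ y z, A y z ≤ 1) (hC : ∀ x y, C x y ≤ 1) (hB : ∀ x z, B x z + B' x z = 1) :
    latentMean mX mY mZ (fun _ y z => A y z) * latentMean mX mY mZ (fun x y _ => C x y) ≤
      latentMean mX mY mZ (fun x y z => A y z * B' x z) +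
        latentMean mX mY mZ (fun x y z => B x z * C x y) := by
  have mean_le_one (f : Y → ℝ≥0∞) (hf : ∀ y, f y ≤ 1) : ∑' y, mY y * f y ≤ 1 :=
    (ENNReal.tsum_le_tsum fun y => mul_le_of_le_one_right' (hf y)).trans_eq hY
  have hmA : latentMean mX mY mZ (fun _ y z => A y z) = ∑' z, mZ z * ∑' y, mY y * A y z := by
    simp only [latentMean_eq_tsum_tsum, mul_assoc, ENNReal.tsum_mul_left, ENNReal.tsum_mul_right,
      hX, one_mul]
  have hmC : latentMean mX mY mZ (fun x y _ => C x y) = ∑' x, mX x * ∑' y, mY y * C x y := by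
    simp only [latentMean_eq_tsum_tsum, ENNReal.tsum_mul_left, ENNReal.tsum_mul_right,
      hZ, mul_one]
  rw [hmA, hmC, mul_comm, ← ENNReal.tsum_mul_right, latentMean_eq_tsum_tsum,
    latentMean_eq_tsum_tsum, ← ENNReal.tsum_add]
  refine ENNReal.tsum_le_tsum fun x => ?_
  rw [← ENNReal.tsum_mul_left, ← ENNReal.tsum_add]
  refine ENNReal.tsum_le_tsum fun z => ?_
  have hAB : ∑' y, mY y * (A y z * B' x z) = (∑' y, mY y * A y z) * B' x z := by
    simp only [← mul_assoc, ENNReal.tsum_mul_right]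
  have hBC : ∑' y, mY y * (B x z * C x y) = B x z * ∑' y, mY y * C x y := by
    simp only [mul_left_comm _ (B x z), ENNReal.tsum_mul_left]
  rw [hAB, hBC]
  set a := ∑' y, mY y * A y z
  set c := ∑' y, mY y * C x y
  have ha : a ≤ 1 := mean_le_one _ fun y => hA y z
  have hc : c ≤ 1 := mean_le_one _ fun y => hC x y
  calc mX x * c * (mZ z * a) = mX x * mZ z * ((B x z + B' x z) * (a * c)) := by
        rw [hB]; ring
    _ = mX x * mZ z * (a * B' x z * c) + mX x * mZ z * (B x z * c * a) := by ring
    _ ≤ mX x * mZ z * (a * B' x z) + mX x * mZ z * (B x z * c) := by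
        gcongr ?_ * ?_ + ?_ * ?_
        exacts [le_rfl, mul_le_of_le_one_right' hc, le_rfl, mul_le_of_le_one_right' ha]

end LatentMean

/-- Nonnegative real expectations of bounded functions agree with extended nonnegative ones. -/
lemma coe_tsum_eq_latentMean {X Y Z : Type*} {μX : X → ℝ≥0} {μY : Y → ℝ≥0} {μZ : Z → ℝ≥0}
    (hX : Summable μX) (hY : Summable μY) (hZ : Summable μZ) {f : X → Y → Z → ℝ≥0}
    (hf : ∀ x y z, f x y z ≤ 1) :
    ((∑' (x : X) (y : Y) (z : Z), μX x * μY y * μZ z * f x y z : ℝ≥0) : ℝ≥0∞) =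
      latentMean (fun x => (μX x : ℝ≥0∞)) (fun y => (μY y : ℝ≥0∞)) (fun z => (μZ z : ℝ≥0∞))
        (fun x y z => (f x y z : ℝ≥0∞)) := by
  have lez (x y z) : μX x * μY y * μZ z * f x y z ≤ μX x * μY y * μZ z :=
    mul_le_of_le_one_right' (hf x y z)
  have sz (x y) : Summable fun z => μX x * μY y * μZ z * f x y z :=
    NNReal.summable_of_le (lez x y) (hZ.mul_left _)
  have ley (x y) : ∑' z, μX x * μY y * μZ z * f x y z ≤ μX x * μY y * ∑' z, μZ z := by
    rw [← NNReal.tsum_mul_left]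
    exact (sz x y).tsum_le_tsum (lez x y) (hZ.mul_left _)
  have sy' (x) : Summable fun y => μX x * μY y * ∑' z, μZ z := (hY.mul_left _).mul_right _
  have sy (x) : Summable fun y => ∑' z, μX x * μY y * μZ z * f x y z :=
    NNReal.summable_of_le (ley x) (sy' x)
  have lex (x) : ∑' (y) (z), μX x * μY y * μZ z * f x y z ≤
      μX x * (∑' y, μY y) * ∑' z, μZ z := by
    rw [← NNReal.tsum_mul_left (μX x), ← NNReal.tsum_mul_right]
    exact (sy x).tsum_le_tsum (ley x) (sy' x)
  have sx : Summable fun x => ∑' (y) (z), μX x * μY y * μZ z * f x y z :=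
    NNReal.summable_of_le lex ((hX.mul_right _).mul_right _)
  rw [ENNReal.coe_tsum sx]
  refine tsum_congr fun x => ?_
  rw [ENNReal.coe_tsum (sy x)]
  refine tsum_congr fun y => ?_
  rw [ENNReal.coe_tsum (sz x y)]
  exact tsum_congr fun z => by push_cast; rfl

/-- The cut inequality `P(A = 0) P(C = 1) ≤ P(A = 0, B = 1) + P(B = 0, C = 1)` satisfied by every
distribution compatible with the Triangle scenario. -/
theorem TriangleCompatible.marginal_mul_marginal_le {P : Fin 2 → Fin 2 → Fin 2 → ℝ}
    (h : TriangleCompatible P) :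
    (∑ b, ∑ c, P 0 b c) * (∑ a, ∑ b, P a b 1) ≤ (∑ c, P 0 1 c) + ∑ a, P a 0 1 := by
  obtain ⟨X, Y, Z, μX, μY, μZ, qA, qB, qC, hX, hY, hZ, hA, hB, hC, hP⟩ := h
  have summable_of_tsum {T : Type} {μ : T → ℝ≥0} (h : ∑' t, μ t = 1) : Summable μ := by
    by_contra hs
    simp [tsum_eq_zero_of_not_summable hs] at h
  have coe_tsum_one {T : Type} {μ : T → ℝ≥0} (h : ∑' t, μ t = 1) :
      ∑' t, (μ t : ℝ≥0∞) = 1 := by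
    rw [← ENNReal.coe_tsum (summable_of_tsum h), h, ENNReal.coe_one]
  have le_one {T : Type} {q : T → Fin 2 → ℝ≥0} (h : ∀ t, ∑ i, q t i = 1) (t : T) (i : Fin 2) :
      q t i ≤ 1 := (Finset.single_le_sum (fun _ _ => zero_le) (Finset.mem_univ i)).trans_eq (h t)
  have coe_sum {T : Type} {q : T → Fin 2 → ℝ≥0} (h : ∀ t, ∑ i, q t i = 1) (t : T) :
      (q t 0 : ℝ≥0∞) + q t 1 = 1 := by
    have := h t
    rw [Fin.sum_univ_two] at this
    exact_mod_cast this
  let M := latentMean (fun x => (μX x : ℝ≥0∞)) (fun y => (μY y : ℝ≥0∞)) (fun z => (μZ z : ℝ≥0∞))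
  obtain ⟨p, hPp, hp⟩ : ∃ p : Fin 2 → Fin 2 → Fin 2 → ℝ≥0, (∀ a b c, P a b c = p a b c) ∧
      ∀ a b c, (p a b c : ℝ≥0∞) = M fun x y z => qA (y, z) a * qB (x, z) b * qC (x, y) c := by
    refine ⟨_, hP, fun a b c => ?_⟩
    have := coe_tsum_eq_latentMean (summable_of_tsum hX) (summable_of_tsum hY)
      (summable_of_tsum hZ) (f := fun x y z => qA (y, z) a * qB (x, z) b * qC (x, y) c)
      fun x y z => mul_le_one' (mul_le_one' (le_one hA _ _) (le_one hB _ _)) (le_one hC _ _)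
    simpa only [mul_assoc, ENNReal.coe_mul] using this
  have hAB (a b) : (p a b 0 + p a b 1 : ℝ≥0∞) = M fun x y z => qA (y, z) a * qB (x, z) b := by
    rw [hp, hp, ← latentMean_add]
    simp only [M, ← mul_add, coe_sum hC, mul_one]
  have hBC (b c) : (p 0 b c + p 1 b c : ℝ≥0∞) = M fun x y z => qB (x, z) b * qC (x, y) c := by
    rw [hp, hp, ← latentMean_add]
    simp only [M, ← add_mul, coe_sum hA, one_mul]
  have hmA (a) : (p a 0 0 + p a 0 1 + (p a 1 0 + p a 1 1) : ℝ≥0∞) = M fun _ y z => qA (y, z) a := by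
    rw [hAB, hAB, ← latentMean_add]
    simp only [M, ← mul_add, coe_sum hB, mul_one]
  have hmC (c) : (p 0 0 c + p 1 0 c + (p 0 1 c + p 1 1 c) : ℝ≥0∞) = M fun x y _ => qC (x, y) c := by
    rw [hBC, hBC, ← latentMean_add]
    simp only [M, ← add_mul, coe_sum hB, one_mul]
  have key := latentMean_mul_latentMean_le (coe_tsum_one hX) (coe_tsum_one hY) (coe_tsum_one hZ)
    (fun y z => (qA (y, z) 0 : ℝ≥0∞)) (fun x z => (qB (x, z) 0 : ℝ≥0∞))
    (fun x z => (qB (x, z) 1 : ℝ≥0∞)) (fun x y => (qC (x, y) 1 : ℝ≥0∞))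
    (fun y z => by exact_mod_cast le_one hA _ _) (fun x y => by exact_mod_cast le_one hC _ _)
    (fun x z => coe_sum hB _)
  change M _ * M _ ≤ M _ + M _ at key
  rw [← hmA, ← hmC, ← hAB, ← hBC] at key
  have key' : (p 0 0 0 + p 0 0 1 + (p 0 1 0 + p 0 1 1) : ℝ) *
      (p 0 0 1 + p 1 0 1 + (p 0 1 1 + p 1 1 1)) ≤
        p 0 1 0 + p 0 1 1 + (p 0 0 1 + p 1 0 1) := by exact_mod_cast key
  simp only [Fin.sum_univ_two, hPp]
  linarith

/-- For `5/8 < α ≤ 1`, the noisy perfectly-correlated distribution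
(`P_α(a,b,c) = α/2` if `a = b = c`, else `(1−α)/6`) is not compatible with the
Triangle scenario. -/
theorem noisy_ghz_not_triangle_compatible (α : ℝ) (hlo : 5 / 8 < α) (hhi : α ≤ 1) :
    ¬ TriangleCompatible
        (fun a b c => if a = b ∧ b = c then α / 2 else (1 - α) / 6) := by
  intro h
  have key := h.marginal_mul_marginal_le
  norm_num [Fin.sum_univ_two] at key
  linarith
end

section
/- For every real α with 0 ≤ α ≤ 1/2, the noisy perfectly-correlated distribution P_α on three binary variables, defined by P_α(a,b,c) = α/2 if a = b = c and P_α(a,b,c) = (1−α)/6 otherwise, is compatible with the Triangle scenario; that is, there exists an explicit latent-variable model of Triangle form realizing P_α. -/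
open scoped BigOperators NNReal

/-- The binary channel that transmits the bit `i` faithfully with weight `r` and flips it with
weight `s`. -/
def bitChannel (r s : ℝ≥0) (i j : Fin 2) : ℝ≥0 := if i = j then r else s

theorem sum_bitChannel {r s : ℝ≥0} (h : r + s = 1) (i : Fin 2) :
    ∑ j, bitChannel r s i j = 1 := by
  fin_cases i
  · simpa [bitChannel] using h
  · simpa [bitChannel, add_comm] using h

/-- For `0 ≤ α ≤ 1/2`, the noisy perfectly-correlated distribution
(`P_α(a,b,c) = α/2` if `a = b = c`, else `(1−α)/6`) is compatible with the Triangle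
scenario. -/
theorem noisy_ghz_triangle_compatible (α : ℝ) (hlo : 0 ≤ α) (hhi : α ≤ 1 / 2) :
    TriangleCompatible
      (fun a b c => if a = b ∧ b = c then α / 2 else (1 - α) / 6) := by
  /- Every source emits a uniform bit, and `Y`, `Z` also emit a flag, raised with probability `1/2`,
  `1/3` respectively. The sources are ranked: flagged `Z`, flagged `Y`, `X`, unflagged
  `Y`, unflagged `Z`. Each source is then the top-ranked one with probability `1/3`. Each party
  copies the bit of its higher-ranked parent, and for each source one of its two children does so
  through a channel transmitting faithfully with probability `2 * α`. -/
  obtain ⟨r, hr⟩ : ∃ r : ℝ≥0, (r : ℝ) = 2 * α := ⟨⟨2 * α, by linarith⟩, rfl⟩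
  obtain ⟨s, hs⟩ : ∃ s : ℝ≥0, (s : ℝ) = 1 - 2 * α := ⟨⟨1 - 2 * α, by linarith⟩, rfl⟩
  have hrs : r + s = 1 := by
    rw [← NNReal.coe_inj]
    push_cast
    linarith
  refine ⟨Fin 2, Fin 2 × Fin 2, Fin 2 × Fin 2, fun _ => 1 / 2, fun _ => 1 / 4,
    fun z => if z.2 = 1 then 1 / 6 else 1 / 3,
    fun p => if p.2.2 = 1 then bitChannel 1 0 p.2.1 else bitChannel r s p.1.1,
    fun p => if p.2.2 = 1 then bitChannel r s p.2.1 else bitChannel 1 0 p.1,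
    fun p => if p.2.2 = 1 then bitChannel 1 0 p.2.1 else bitChannel r s p.1,
    ?_, ?_, ?_, ?_, ?_, ?_, ?_⟩
  · rw [tsum_fintype, ← NNReal.coe_inj]
    norm_num
  · rw [tsum_fintype, ← NNReal.coe_inj]
    norm_num
  · rw [tsum_fintype, ← NNReal.coe_inj]
    norm_num [Fintype.sum_prod_type]
  · intro p
    dsimp only
    split_ifs
    exacts [sum_bitChannel (add_zero 1) _, sum_bitChannel hrs _]
  · intro p
    dsimp only
    split_ifs
    exacts [sum_bitChannel hrs _, sum_bitChannel (add_zero 1) _]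
  · intro p
    dsimp only
    split_ifs
    exacts [sum_bitChannel (add_zero 1) _, sum_bitChannel hrs _]
  · intro a b c
    simp only [tsum_fintype, Fintype.sum_prod_type, Fin.sum_univ_two]
    fin_cases a <;> fin_cases b <;> fin_cases c <;>
      simp [bitChannel, hr, hs] <;> ring
end

section
/- If a probability distribution P on ({0,1})^3 with coordinates A, B, C is compatible with the Triangle scenario, then I(A:C) + I(C:B) ≤ H(C), where H denotes Shannon entropy of the indicated marginal of P and I(U:V) := H(U) + H(V) − H(U,V) denotes mutual information. -/
open scoped BigOperators NNReal

/-- Shannon entropy of a probability distribution on a finite type,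
with the convention `0 · log 0 = 0` (automatic since `Real.log 0 = 0`). -/
noncomputable def shannonEntropy {W : Type*} [Fintype W] (p : W → ℝ) : ℝ :=
  -∑ w, p w * Real.log (p w)

/-- A distribution of `(A, B, C)` for which `A` and `B` are independent satisfies
`H(A) + H(B) + H(C) ≤ H(A,C) + H(C,B)`, that is, `I(A:C) + I(C:B) ≤ H(C)`. -/
theorem shannonEntropy_add_le_of_independent {α β γ : Type*} [Fintype α] [Fintype β] [Fintype γ]
    (Q : α → β → γ → ℝ) (hQ0 : ∀ a b c, 0 ≤ Q a b c) (hQ1 : ∑ a, ∑ b, ∑ c, Q a b c = 1)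
    (hind : ∀ a b, ∑ c, Q a b c = (∑ b, ∑ c, Q a b c) * ∑ a, ∑ c, Q a b c) :
    shannonEntropy (fun a => ∑ b, ∑ c, Q a b c) + shannonEntropy (fun b => ∑ a, ∑ c, Q a b c)
        + shannonEntropy (fun c => ∑ a, ∑ b, Q a b c) ≤
      shannonEntropy (fun ac : α × γ => ∑ b, Q ac.1 b ac.2)
        + shannonEntropy (fun cb : γ × β => ∑ a, Q a cb.2 cb.1) := by
  obtain ⟨p, hp⟩ : ∃ p : α → ℝ, ∀ a, ∑ b, ∑ c, Q a b c = p a := ⟨_, fun _ => rfl⟩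
  obtain ⟨s, hs⟩ : ∃ s : β → ℝ, ∀ b, ∑ a, ∑ c, Q a b c = s b := ⟨_, fun _ => rfl⟩
  obtain ⟨u, hu⟩ : ∃ u : γ → ℝ, ∀ c, ∑ a, ∑ b, Q a b c = u c := ⟨_, fun _ => rfl⟩
  obtain ⟨v, hv⟩ : ∃ v : α → γ → ℝ, ∀ a c, ∑ b, Q a b c = v a c := ⟨_, fun _ _ => rfl⟩
  obtain ⟨w, hw⟩ : ∃ w : γ → β → ℝ, ∀ c b, ∑ a, Q a b c = w c b := ⟨_, fun _ _ => rfl⟩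
  have hv0 a c : 0 ≤ v a c := hv a c ▸ Finset.sum_nonneg fun _ _ => hQ0 _ _ _
  have hw0 c b : 0 ≤ w c b := hw c b ▸ Finset.sum_nonneg fun _ _ => hQ0 _ _ _
  have hvu c : ∑ a, v a c = u c := by simp only [← hv, hu]
  have hwu c : ∑ b, w c b = u c := by
    simp only [← hw, ← hu]; exact Finset.sum_comm
  have hu0 c : 0 ≤ u c := hvu c ▸ Finset.sum_nonneg fun _ _ => hv0 _ _
  have hQv a b c : Q a b c ≤ v a c :=
    hv a c ▸ Finset.single_le_sum (f := fun b => Q a b c) (fun _ _ => hQ0 _ _ _)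
      (Finset.mem_univ b)
  have hQw a b c : Q a b c ≤ w c b :=
    hw c b ▸ Finset.single_le_sum (f := fun a => Q a b c) (fun _ _ => hQ0 _ _ _)
      (Finset.mem_univ a)
  have hvle a c : v a c ≤ u c :=
    hvu c ▸ Finset.single_le_sum (f := fun a => v a c) (fun _ _ => hv0 _ _) (Finset.mem_univ a)
  have hQps a b c : Q a b c ≤ p a * s b := by
    rw [← hp, ← hs, ← hind]
    exact Finset.single_le_sum (f := fun c => Q a b c) (fun _ _ => hQ0 _ _ _) (Finset.mem_univ c)
  have hs0 b : 0 ≤ s b := hs b ▸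
    Finset.sum_nonneg fun _ _ => Finset.sum_nonneg fun _ _ => hQ0 _ _ _
  have hpoint a b c : Q a b c - v a c * w c b / u c ≤
      Q a b c * (Real.log (p a) + Real.log (s b) + Real.log (u c)
        - Real.log (v a c) - Real.log (w c b)) := by
    rcases (hQ0 a b c).eq_or_lt with h | h
    · rw [← h]
      have : 0 ≤ v a c * w c b / u c := div_nonneg (mul_nonneg (hv0 a c) (hw0 c b)) (hu0 c)
      linarith
    · have hvp : 0 < v a c := h.trans_le (hQv a b c)
      have hwp : 0 < w c b := h.trans_le (hQw a b c)
      have hup : 0 < u c := hvp.trans_le (hvle a c)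
      have hps : 0 < p a * s b := h.trans_le (hQps a b c)
      have hsp : 0 < s b := (hs0 b).lt_of_ne fun h' => by simp [← h'] at hps
      have hpp : 0 < p a := pos_of_mul_pos_left hps hsp.le
      have hlog := Real.log_le_sub_one_of_pos
        (show 0 < v a c * w c b / (p a * s b * u c) by positivity)
      rw [Real.log_div (by positivity) (by positivity), Real.log_mul hvp.ne' hwp.ne',
        Real.log_mul hps.ne' hup.ne', Real.log_mul hpp.ne' hsp.ne'] at hlog
      have hratio : Q a b c * (v a c * w c b / (p a * s b * u c)) ≤ v a c * w c b / u c := by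
        calc _ ≤ p a * s b * (v a c * w c b / (p a * s b * u c)) := by
              gcongr; exact hQps a b c
          _ = _ := by field_simp
      nlinarith [mul_le_mul_of_nonneg_left hlog h.le]
  have hsum := Finset.sum_le_sum fun a (_ : a ∈ Finset.univ) =>
    Finset.sum_le_sum fun b (_ : b ∈ Finset.univ) =>
      Finset.sum_le_sum fun c (_ : c ∈ Finset.univ) => hpoint a b c
  have hone : ∑ a, ∑ b, ∑ c, v a c * w c b / u c = 1 := by
    calc _ = ∑ a, ∑ c, ∑ b, v a c * w c b / u c :=
          Finset.sum_congr rfl fun _ _ => Finset.sum_comm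
      _ = ∑ c, ∑ a, ∑ b, v a c * w c b / u c := Finset.sum_comm
      _ = ∑ c, u c := Finset.sum_congr rfl fun c _ => by
          simp only [← Finset.sum_div, ← Finset.mul_sum, ← Finset.sum_mul, hvu, hwu]
          exact mul_self_div_self _
      _ = ∑ a, ∑ b, ∑ c, Q a b c := by
          simp only [← hu]
          rw [Finset.sum_comm]
          exact Finset.sum_congr rfl fun _ _ => Finset.sum_comm
      _ = 1 := hQ1
  have ep : ∑ a, ∑ b, ∑ c, Q a b c * Real.log (p a) = ∑ a, p a * Real.log (p a) := by
    simp only [← Finset.sum_mul, hp]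
  have es : ∑ a, ∑ b, ∑ c, Q a b c * Real.log (s b) = ∑ b, s b * Real.log (s b) := by
    rw [Finset.sum_comm]
    simp only [← Finset.sum_mul, hs]
  have ev : ∑ a, ∑ b, ∑ c, Q a b c * Real.log (v a c) =
      ∑ a, ∑ c, v a c * Real.log (v a c) := by
    refine Finset.sum_congr rfl fun a _ => ?_
    rw [Finset.sum_comm]
    simp only [← Finset.sum_mul, hv]
  have ew : ∑ a, ∑ b, ∑ c, Q a b c * Real.log (w c b) =
      ∑ c, ∑ b, w c b * Real.log (w c b) := by
    rw [Finset.sum_comm, Finset.sum_comm (γ := γ)]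
    refine Finset.sum_congr rfl fun b _ => ?_
    rw [Finset.sum_comm]
    simp only [← Finset.sum_mul, hw]
  have eu : ∑ a, ∑ b, ∑ c, Q a b c * Real.log (u c) = ∑ c, u c * Real.log (u c) := by
    calc _ = ∑ a, ∑ c, ∑ b, Q a b c * Real.log (u c) :=
          Finset.sum_congr rfl fun _ _ => Finset.sum_comm
      _ = ∑ c, ∑ a, ∑ b, Q a b c * Real.log (u c) := Finset.sum_comm
      _ = _ := by simp only [← Finset.sum_mul, hu]
  simp only [mul_sub, mul_add, Finset.sum_sub_distrib, Finset.sum_add_distrib, hone, hQ1,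
    ep, es, eu, ev, ew] at hsum
  simp only [shannonEntropy, Fintype.sum_prod_type, hp, hs, hv, hvu, hw]
  linarith

section WeightedSums

variable {ι : Type*} {μ : ι → ℝ≥0}

theorem summable_mul_of_tsum_eq_one (hμ : ∑' i, μ i = 1) {g : ι → ℝ≥0} (hg : ∀ i, g i ≤ 1) :
    Summable fun i => μ i * g i := by
  have hs : Summable μ := by
    by_contra h
    simp [tsum_eq_zero_of_not_summable h] at hμ
  exact NNReal.summable_of_le (fun i => mul_le_of_le_one_right' (hg i)) hs

theorem tsum_mul_le_one (hμ : ∑' i, μ i = 1) {g : ι → ℝ≥0} (hg : ∀ i, g i ≤ 1) :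
    ∑' i, μ i * g i ≤ 1 := by
  have h1 := summable_mul_of_tsum_eq_one hμ (g := 1) fun _ => le_rfl
  simp only [Pi.one_apply, mul_one] at h1
  exact hμ ▸ (summable_mul_of_tsum_eq_one hμ hg).tsum_le_tsum
    (fun i => mul_le_of_le_one_right' (hg i)) h1

theorem sum_tsum_mul {κ : Type*} [Fintype κ] (hμ : ∑' i, μ i = 1) {g : κ → ι → ℝ≥0}
    (hg : ∀ k i, g k i ≤ 1) :
    ∑ k, ∑' i, μ i * g k i = ∑' i, μ i * ∑ k, g k i := by
  simp only [Finset.mul_sum]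
  exact (Summable.tsum_finsetSum fun k _ => summable_mul_of_tsum_eq_one hμ (hg k)).symm

end WeightedSums

/-- Cutting the latent variable shared by `A` and `B` into two independent copies keeps the
marginals on `(A, C)` and `(B, C)` and makes `A` and `B` independent. -/
theorem TriangleCompatible.exists_cut {P : Fin 2 → Fin 2 → Fin 2 → ℝ} (h : TriangleCompatible P) :
    ∃ Q : Fin 2 → Fin 2 → Fin 2 → ℝ, (∀ a b c, 0 ≤ Q a b c) ∧
      (∀ a c, ∑ b, P a b c = ∑ b, Q a b c) ∧ (∀ b c, ∑ a, P a b c = ∑ a, Q a b c) ∧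
      ∀ a b, ∑ c, Q a b c = (∑ b, ∑ c, Q a b c) * ∑ a, ∑ c, Q a b c := by
  obtain ⟨X, Y, Z, μX, μY, μZ, qA, qB, qC, hX, hY, hZ, hA, hB, hC, hP⟩ := h
  have le_one {q : Fin 2 → ℝ≥0} (hq : ∑ i, q i = 1) (i : Fin 2) : q i ≤ 1 :=
    hq ▸ Finset.single_le_sum (fun _ _ => zero_le) (Finset.mem_univ i)
  obtain ⟨rA, hrA⟩ : ∃ rA : Y → Fin 2 → ℝ≥0, ∀ y a, ∑' z, μZ z * qA (y, z) a = rA y a :=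
    ⟨_, fun _ _ => rfl⟩
  obtain ⟨rB, hrB⟩ : ∃ rB : X → Fin 2 → ℝ≥0, ∀ x b, ∑' z, μZ z * qB (x, z) b = rB x b :=
    ⟨_, fun _ _ => rfl⟩
  have hrA1 y : ∑ a, rA y a = 1 := by
    simp only [← hrA]
    rw [sum_tsum_mul hZ fun a z => le_one (hA (y, z)) a]
    simp [hA, hZ]
  have hrB1 x : ∑ b, rB x b = 1 := by
    simp only [← hrB]
    rw [sum_tsum_mul hZ fun b z => le_one (hB (x, z)) b]
    simp [hB, hZ]
  have le3 {s t r : ℝ≥0} (hs : s ≤ 1) (ht : t ≤ 1) (hr : r ≤ 1) : s * t * r ≤ 1 :=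
    mul_le_one' (mul_le_one' hs ht) hr
  have bP a b c x y z : qA (y, z) a * qB (x, z) b * qC (x, y) c ≤ 1 :=
    le3 (le_one (hA _) _) (le_one (hB _) _) (le_one (hC _) _)
  have bQ a b c x y : rA y a * rB x b * qC (x, y) c ≤ 1 :=
    le3 (le_one (hrA1 _) _) (le_one (hrB1 _) _) (le_one (hC _) _)
  have hP' a b c : P a b c = ((∑' x, μX x * ∑' y, μY y * ∑' z, μZ z *
      (qA (y, z) a * qB (x, z) b * qC (x, y) c) : ℝ≥0) : ℝ) := by
    rw [hP]
    simp only [mul_assoc, tsum_mul_left]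
  refine ⟨fun a b c => ((∑' x, μX x * ∑' y, μY y * (rA y a * rB x b * qC (x, y) c) : ℝ≥0) : ℝ),
    fun _ _ _ => NNReal.coe_nonneg _, fun a c => ?_, fun b c => ?_, ?_⟩
  · simp only [hP', ← NNReal.coe_sum, NNReal.coe_inj]
    rw [sum_tsum_mul hX fun b x => tsum_mul_le_one hY fun y => tsum_mul_le_one hZ (bP a b c x y),
      sum_tsum_mul hX fun b x => tsum_mul_le_one hY (bQ a b c x)]
    congr! 3 with x
    rw [sum_tsum_mul hY fun b y => tsum_mul_le_one hZ (bP a b c x y),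
      sum_tsum_mul hY fun b => bQ a b c x]
    congr! 3 with y
    rw [sum_tsum_mul hZ fun b => bP a b c x y]
    simp only [← Finset.sum_mul, ← Finset.mul_sum, hB, hrB1, mul_one, ← mul_assoc,
      tsum_mul_right, hrA]
  · simp only [hP', ← NNReal.coe_sum, NNReal.coe_inj]
    rw [sum_tsum_mul hX fun a x => tsum_mul_le_one hY fun y => tsum_mul_le_one hZ (bP a b c x y),
      sum_tsum_mul hX fun a x => tsum_mul_le_one hY (bQ a b c x)]
    congr! 3 with x
    rw [sum_tsum_mul hY fun a y => tsum_mul_le_one hZ (bP a b c x y),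
      sum_tsum_mul hY fun a => bQ a b c x]
    congr! 3 with y
    rw [sum_tsum_mul hZ fun a => bP a b c x y]
    simp only [← Finset.sum_mul, hA, hrA1, one_mul, ← mul_assoc, tsum_mul_right, hrB]
  · have hAB a b : ∑ c, ∑' x, μX x * ∑' y, μY y * (rA y a * rB x b * qC (x, y) c) =
        (∑' y, μY y * rA y a) * ∑' x, μX x * rB x b := by
      rw [sum_tsum_mul hX fun c x => tsum_mul_le_one hY (bQ a b c x), ← tsum_mul_left]
      congr! 2 with x
      rw [sum_tsum_mul hY fun c => bQ a b c x]
      simp only [← Finset.mul_sum, hC, mul_one, ← mul_assoc, tsum_mul_right]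
      ring
    have eA : ∑ a, ∑' y, μY y * rA y a = 1 := by
      rw [sum_tsum_mul hY fun a y => le_one (hrA1 y) a]
      simp [hrA1, hY]
    have eB : ∑ b, ∑' x, μX x * rB x b = 1 := by
      rw [sum_tsum_mul hX fun b x => le_one (hrB1 x) b]
      simp [hrB1, hX]
    intro a b
    simp only [← NNReal.coe_sum, ← NNReal.coe_mul, hAB, ← Finset.mul_sum,
      ← Finset.sum_mul, eA, eB, mul_one, one_mul]

/-- If a probability distribution `P` on `{0,1}³` with coordinates `A`, `B`, `C` is
compatible with the Triangle scenario, then `I(A:C) + I(C:B) ≤ H(C)`, where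
`I(U:V) = H(U) + H(V) − H(U,V)`. -/
theorem triangle_entropic_inequality (P : Fin 2 → Fin 2 → Fin 2 → ℝ)
    (hP0 : ∀ a b c, 0 ≤ P a b c)
    (hP1 : ∑ a, ∑ b, ∑ c, P a b c = 1)
    (hcomp : TriangleCompatible P) :
    (shannonEntropy (fun a => ∑ b, ∑ c, P a b c)
        + shannonEntropy (fun c => ∑ a, ∑ b, P a b c)
        - shannonEntropy (fun ac : Fin 2 × Fin 2 => ∑ b, P ac.1 b ac.2))
      + (shannonEntropy (fun c => ∑ a, ∑ b, P a b c)
        + shannonEntropy (fun b => ∑ a, ∑ c, P a b c)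
        - shannonEntropy (fun cb : Fin 2 × Fin 2 => ∑ a, P a cb.2 cb.1)) ≤
      shannonEntropy (fun c => ∑ a, ∑ b, P a b c) := by
  obtain ⟨Q, hQ0, hAC, hBC, hind⟩ := hcomp.exists_cut
  have hA a : ∑ b, ∑ c, P a b c = ∑ b, ∑ c, Q a b c := by
    rw [Finset.sum_comm, Finset.sum_comm (f := fun b c => Q a b c)]
    exact Finset.sum_congr rfl fun c _ => hAC a c
  have hB b : ∑ a, ∑ c, P a b c = ∑ a, ∑ c, Q a b c := by
    rw [Finset.sum_comm, Finset.sum_comm (f := fun a c => Q a b c)]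
    exact Finset.sum_congr rfl fun c _ => hBC b c
  have hQ1 : ∑ a, ∑ b, ∑ c, Q a b c = 1 := by
    simp only [← hA, hP1]
  simp only [hA, hB, hAC, hBC]
  linarith [shannonEntropy_add_le_of_independent Q hQ0 hQ1 hind]
end
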